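/- Let n be a positive integer and let W₁, W₂ be two non-empty closed spherically convex subsets of the unit sphere Sⁿ ⊆ ℝ^{n+1} with W₁ ∩ W₂ = ∅. Then for every δ > 0 there exist P ∈ Sⁿ and r ∈ ℝ with |r| < δ such that P·Q > r for every Q ∈ W₁ and P·R < r for every R ∈ W₂. -/

import Mathlib

open scoped RealInnerProductSpace

/-- A subset `W` of the unit sphere `Sⁿ ⊆ ℝ^{n+1}` is spherically convex if it is
hemispherical (there is `P ∈ Sⁿ` with `P·Q > 0` for all `Q ∈ W`) and for any
`P, Q ∈ W` and `t ∈ [0,1]` the unit vector `(tP + (1-t)Q)/‖tP + (1-t)Q‖` lies in `W`. -/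
def SphericallyConvex {n : ℕ} (W : Set (EuclideanSpace ℝ (Fin (n + 1)))) : Prop :=
  (∃ P ∈ Metric.sphere (0 : EuclideanSpace ℝ (Fin (n + 1))) 1, ∀ Q ∈ W, 0 < ⟪P, Q⟫) ∧
    ∀ P ∈ W, ∀ Q ∈ W, ∀ t ∈ Set.Icc (0 : ℝ) 1,
      ‖t • P + (1 - t) • Q‖⁻¹ • (t • P + (1 - t) • Q) ∈ W

/-- The cone over a spherically convex set, without its apex, is convex. -/
theorem SphericallyConvex.convex_cone {n : ℕ}
    {W : Set (EuclideanSpace ℝ (Fin (n + 1)))} (hW : SphericallyConvex W)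
    (hsub : W ⊆ Metric.sphere 0 1) : Convex ℝ {x | ‖x‖⁻¹ • x ∈ W} := by
  have hpos : ∀ x : EuclideanSpace ℝ (Fin (n + 1)), ‖x‖⁻¹ • x ∈ W → 0 < ‖x‖ := by
    intro x hx
    rw [norm_pos_iff]
    rintro rfl
    have := hsub hx
    simp at this
  intro x hx y hy a b ha hb hab
  have hx0 := hpos x hx
  have hy0 := hpos y hy
  have hs : 0 < a * ‖x‖ + b * ‖y‖ := by
    rcases ha.eq_or_lt with rfl | ha'
    · have : b = 1 := by linarith
      simpa [this] using hy0
    · positivity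
  have hmem := hW.2 _ hx _ hy (a * ‖x‖ / (a * ‖x‖ + b * ‖y‖))
    ⟨by positivity, by rw [div_le_one hs]; nlinarith⟩
  have hcomb : (a * ‖x‖ / (a * ‖x‖ + b * ‖y‖)) • ‖x‖⁻¹ • x +
      (1 - a * ‖x‖ / (a * ‖x‖ + b * ‖y‖)) • ‖y‖⁻¹ • y =
      (a * ‖x‖ + b * ‖y‖)⁻¹ • (a • x + b • y) := by
    rw [smul_add, smul_smul, smul_smul, smul_smul, smul_smul]
    congr 2 <;> field_simp
    ring
  rw [hcomb, norm_smul, Real.norm_of_nonneg (inv_pos.2 hs).le, smul_smul] at hmem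
  change ‖a • x + b • y‖⁻¹ • (a • x + b • y) ∈ W
  convert hmem using 2
  field_simp

/-- A central projection of a compact spherically convex set onto an affine hyperplane yields
a compact convex set spanning the same cone. -/
theorem SphericallyConvex.exists_isCompact_convex {n : ℕ}
    {W : Set (EuclideanSpace ℝ (Fin (n + 1)))} (hW : SphericallyConvex W)
    (hsub : W ⊆ Metric.sphere 0 1) (hc : IsCompact W) :
    ∃ A : Set (EuclideanSpace ℝ (Fin (n + 1))), IsCompact A ∧ Convex ℝ A ∧
      (∀ x ∈ A, ‖x‖⁻¹ • x ∈ W) ∧ ∀ Q ∈ W, ∃ c : ℝ, 0 < c ∧ c • Q ∈ A := by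
  obtain ⟨P, -, hP⟩ := hW.1
  have hA : (fun Q => ⟪P, Q⟫⁻¹ • Q) '' W = {x | ‖x‖⁻¹ • x ∈ W} ∩ {x | ⟪P, x⟫ = 1} := by
    ext x
    constructor
    · rintro ⟨Q, hQ, rfl⟩
      have hQ1 : ‖Q‖ = 1 := by simpa using hsub hQ
      have h := hP Q hQ
      constructor
      · change ‖⟪P, Q⟫⁻¹ • Q‖⁻¹ • ⟪P, Q⟫⁻¹ • Q ∈ W
        rw [norm_smul, Real.norm_of_nonneg (inv_pos.2 h).le, hQ1, mul_one, inv_inv,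
          smul_inv_smul₀ h.ne']
        exact hQ
      · simp [real_inner_smul_right, h.ne']
    · rintro ⟨hx, hx1⟩
      have hx1' : ⟪P, x⟫ = 1 := hx1
      have hx0 : ‖x‖ ≠ 0 := by
        rw [norm_ne_zero_iff]
        rintro rfl
        simp at hx1'
      refine ⟨_, hx, ?_⟩
      simp [real_inner_smul_right, hx1', smul_smul, hx0]
  refine ⟨(fun Q => ⟪P, Q⟫⁻¹ • Q) '' W, hc.image_of_continuousOn ?_, ?_, ?_, fun Q hQ =>
    ⟨_, inv_pos.2 (hP Q hQ), Q, hQ, rfl⟩⟩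
  · exact (ContinuousOn.inv₀ (by fun_prop) fun Q hQ => (hP Q hQ).ne').smul continuousOn_id
  · rw [hA]
    refine (hW.convex_cone hsub).inter ?_
    exact convex_hyperplane (f := fun x => ⟪P, x⟫) (innerₛₗ ℝ P).isLinear 1
  · rw [hA]
    exact fun x hx => hx.1

/-- The convex join of two compact sets is compact. -/
theorem IsCompact.convexJoin {E : Type*} [AddCommGroup E] [Module ℝ E] [TopologicalSpace E]
    [ContinuousAdd E] [ContinuousSMul ℝ E] {s t : Set E} (hs : IsCompact s) (ht : IsCompact t) :
    IsCompact (convexJoin ℝ s t) := by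
  have himg : _root_.convexJoin ℝ s t =
      (fun p : ℝ × E × E => (1 - p.1) • p.2.1 + p.1 • p.2.2) '' Set.Icc 0 1 ×ˢ s ×ˢ t := by
    ext z
    simp only [mem_convexJoin, segment_eq_image, Set.mem_image, Set.mem_prod, Prod.exists]
    constructor
    · rintro ⟨x, hx, y, hy, r, hr, h⟩
      exact ⟨r, x, y, ⟨hr, hx, hy⟩, h⟩
    · rintro ⟨r, x, y, ⟨hr, hx, hy⟩, h⟩
      exact ⟨x, hx, y, hy, r, hr, h⟩
  rw [himg]
  exact (isCompact_Icc.prod (hs.prod ht)).image (by fun_prop)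

/-- Disjoint compact spherically convex sets are strictly separated by a linear hyperplane. -/
theorem SphericallyConvex.exists_sphere_inner_pos_neg {n : ℕ}
    {W₁ W₂ : Set (EuclideanSpace ℝ (Fin (n + 1)))}
    (h₁ : SphericallyConvex W₁) (h₂ : SphericallyConvex W₂)
    (hsub₁ : W₁ ⊆ Metric.sphere 0 1) (hsub₂ : W₂ ⊆ Metric.sphere 0 1)
    (hne₁ : W₁.Nonempty) (hne₂ : W₂.Nonempty)
    (hc₁ : IsCompact W₁) (hc₂ : IsCompact W₂) (hdisj : Disjoint W₁ W₂) :
    ∃ P ∈ Metric.sphere (0 : EuclideanSpace ℝ (Fin (n + 1))) 1,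
      (∀ Q ∈ W₁, 0 < ⟪P, Q⟫) ∧ ∀ R ∈ W₂, ⟪P, R⟫ < 0 := by
  obtain ⟨A, hAc, hAconv, hAW, hWA⟩ := h₁.exists_isCompact_convex hsub₁ hc₁
  obtain ⟨B, hBc, hBconv, hBW, hWB⟩ := h₂.exists_isCompact_convex hsub₂ hc₂
  have hA : A.Nonempty := hne₁.elim fun Q hQ => (hWA Q hQ).elim fun _ h => ⟨_, h.2⟩
  have hB : B.Nonempty := hne₂.elim fun Q hQ => (hWB Q hQ).elim fun _ h => ⟨_, h.2⟩
  have hK : (0 : EuclideanSpace ℝ (Fin (n + 1))) ∉ convexJoin ℝ A (-B) := by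
    rw [mem_convexJoin]
    rintro ⟨x, hx, z, hz, a, b, ha, hb, hab, h0⟩
    have hx' := hAW x hx
    have hy' := hBW (-z) hz
    have hx0 : x ≠ 0 := by
      rintro rfl
      have := hsub₁ hx'
      simp at this
    have hz0 : z ≠ 0 := by
      rintro rfl
      have := hsub₂ hy'
      simp at this
    have ha' : 0 < a := by
      refine ha.lt_of_ne ?_
      rintro rfl
      exact hz0 (by simpa [show b = 1 by linarith] using h0)
    have hb' : 0 < b := by
      refine hb.lt_of_ne ?_
      rintro rfl
      exact hx0 (by simpa [show a = 1 by linarith] using h0)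
    have hray : SameRay ℝ x (-z) :=
      Or.inr (Or.inr ⟨a, b, ha', hb', by rw [smul_neg]; exact eq_neg_of_add_eq_zero_left h0⟩)
    have heq := (sameRay_iff_inv_norm_smul_eq_of_ne hx0 (neg_ne_zero.2 hz0)).1 hray
    exact Set.disjoint_left.1 hdisj hx' (heq ▸ hy')
  obtain ⟨f, u, hu, hf⟩ := geometric_hahn_banach_point_closed (hAconv.convexJoin hBconv.neg)
    (hAc.convexJoin hBc.neg).isClosed hK
  rw [map_zero] at hu
  set v := (InnerProductSpace.toDual ℝ (EuclideanSpace ℝ (Fin (n + 1)))).symm f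
  have hfv : ∀ x, f x = ⟪v, x⟫ := fun x => (InnerProductSpace.toDual_symm_apply).symm
  have hpos₁ : ∀ Q ∈ W₁, 0 < ⟪v, Q⟫ := by
    intro Q hQ
    obtain ⟨c, hc, hcQ⟩ := hWA Q hQ
    have := hu.trans (hf _ (subset_convexJoin_left hB.neg hcQ))
    rw [hfv, real_inner_smul_right] at this
    exact pos_of_mul_pos_right this hc.le
  have hpos₂ : ∀ R ∈ W₂, ⟪v, R⟫ < 0 := by
    intro R hR
    obtain ⟨c, hc, hcR⟩ := hWB R hR
    have := hu.trans (hf _ (subset_convexJoin_right hA (Set.neg_mem_neg.2 hcR)))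
    rw [hfv, inner_neg_right, real_inner_smul_right] at this
    exact neg_of_mul_neg_right (neg_pos.1 this) hc.le
  have hv0 : v ≠ 0 := by
    intro h
    obtain ⟨x, hx⟩ := hne₁
    have := hpos₁ x hx
    simp [h] at this
  have hn : 0 < ‖v‖⁻¹ := inv_pos.2 (norm_pos_iff.2 hv0)
  refine ⟨‖v‖⁻¹ • v, by simpa using norm_smul_inv_norm (𝕜 := ℝ) hv0, fun Q hQ => ?_, fun R hR => ?_⟩
  · rw [real_inner_smul_left]
    exact mul_pos hn (hpos₁ Q hQ)
  · rw [real_inner_smul_left]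
    exact mul_neg_of_pos_of_neg hn (hpos₂ R hR)

/-- A relatively closed subset of a compact set is compact. -/
theorem IsCompact.of_isClosed_preimage_coe {X : Type*} [TopologicalSpace X] {S W : Set X}
    (hS : IsCompact S) (hsub : W ⊆ S) (hcl : IsClosed {x : S | (x : X) ∈ W}) : IsCompact W := by
  have := isCompact_iff_compactSpace.1 hS
  have himg := hcl.isCompact.image continuous_subtype_val
  rwa [show {x : S | (x : X) ∈ W} = Subtype.val ⁻¹' W from rfl, Subtype.image_preimage_coe,
    Set.inter_eq_right.2 hsub] at himg

theorem stmt_10 (n : ℕ) (hn : 0 < n)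
    (W₁ W₂ : Set (EuclideanSpace ℝ (Fin (n + 1))))
    (hW₁sub : W₁ ⊆ Metric.sphere 0 1) (hW₂sub : W₂ ⊆ Metric.sphere 0 1)
    (hW₁ne : W₁.Nonempty) (hW₂ne : W₂.Nonempty)
    (hW₁cl : IsClosed {x : Metric.sphere (0 : EuclideanSpace ℝ (Fin (n + 1))) 1 |
      (x : EuclideanSpace ℝ (Fin (n + 1))) ∈ W₁})
    (hW₂cl : IsClosed {x : Metric.sphere (0 : EuclideanSpace ℝ (Fin (n + 1))) 1 |
      (x : EuclideanSpace ℝ (Fin (n + 1))) ∈ W₂})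
    (hW₁conv : SphericallyConvex W₁) (hW₂conv : SphericallyConvex W₂)
    (hdisj : W₁ ∩ W₂ = ∅) :
    ∀ δ : ℝ, 0 < δ →
      ∃ P ∈ Metric.sphere (0 : EuclideanSpace ℝ (Fin (n + 1))) 1, ∃ r : ℝ, |r| < δ ∧
        (∀ Q ∈ W₁, r < ⟪P, Q⟫) ∧ (∀ R ∈ W₂, ⟪P, R⟫ < r) := by
  intro δ hδ
  obtain ⟨P, hP, hpos, hneg⟩ := hW₁conv.exists_sphere_inner_pos_neg hW₂conv hW₁sub hW₂sub
    hW₁ne hW₂ne ((isCompact_sphere _ _).of_isClosed_preimage_coe hW₁sub hW₁cl)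
    ((isCompact_sphere _ _).of_isClosed_preimage_coe hW₂sub hW₂cl)
    (Set.disjoint_iff_inter_eq_empty.2 hdisj)
  exact ⟨P, hP, 0, by simpa using hδ, hpos, hneg⟩
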